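/- Let X be a real Banach space, f ∈ X, and let N : X → X be analytic at f with infinite radius of convergence. Assume ‖N^{(n)}(f)‖ ≤ M a^n n! for all n ∈ ℕ, where M, a > 0 satisfy Ma ≤ 1/4. Then for every ε ∈ [0,1] the series U(ε) := ∑_{n=0}^{∞} ε^n u_n converges absolutely in X and one has N(U(ε)) = ∑_{n=0}^{∞} ε^n u_{n+1}, this series also converging absolutely. -/

import Mathlib

open scoped BigOperators

variable {X : Type*} [NormedAddCommGroup X] [NormedSpace ℝ X] [CompleteSpace X]

/-- The set of tuples `(j 0, …, j (n-1))` of nonnegative integers (representing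
`(j_1, …, j_n)`) with `j_1 + 2 j_2 + ⋯ + n j_n = n`. -/
def adomianTuples (n : ℕ) : Finset (Fin n → ℕ) :=
  (Fintype.piFinset fun _ : Fin n => Finset.range (n + 1)).filter
    fun j => ∑ i : Fin n, (i.1 + 1) * j i = n

/-- The list consisting of `j i` copies of `g i`, for `i = 0, …, n-1` in order. -/
def repList {X : Type*} {n : ℕ} (j : Fin n → ℕ) (g : Fin n → X) : List X :=
  (List.ofFn fun i => List.replicate (j i) (g i)).flatten

theorem repList_length {X : Type*} {n : ℕ} (j : Fin n → ℕ) (g : Fin n → X) :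
    (repList j g).length = ∑ i : Fin n, j i := by
  simp [repList, List.length_flatten, List.map_ofFn, Function.comp_def, List.sum_ofFn]

/-- The family of arguments `g 0, …, g 0, g 1, …, g 1, …` with `g i` repeated `j i` times,
indexed by `Fin (∑ i, j i)`: this realizes the application
`F.(x_1^{[j_1]} ⋯ x_n^{[j_n]})` of a (symmetric) multilinear map `F`. -/
def repArgs {X : Type*} {n : ℕ} (j : Fin n → ℕ) (g : Fin n → X) :
    Fin (∑ i : Fin n, j i) → X :=
  fun k => (repList j g).get (Fin.cast (repList_length j g).symm k)

/-- The `n`-th Adomian polynomial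
`A_n = ∑_{j_1+2j_2+⋯+nj_n=n} (1/(j_1!⋯j_n!)) N^{(j_1+⋯+j_n)}(f).(u_1^{[j_1]} ⋯ u_n^{[j_n]})`,
where `N^{(p)}(f)` is the `p`-th (iterated Fréchet) derivative of `N` at `f`. -/
noncomputable def adomianA (N : X → X) (f : X) (u : ℕ → X) (n : ℕ) : X :=
  ∑ j ∈ adomianTuples n,
    (∏ i : Fin n, ((j i).factorial : ℝ))⁻¹ •
      iteratedFDeriv ℝ (∑ i : Fin n, j i) N f (repArgs j fun i => u (i.1 + 1))

/-- `N` is analytic at `f` with infinite radius of convergence: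
`N x = N f + ∑_{p≥1} (1/p!) N^{(p)}(f).(x-f)^{[p]}` for every `x ∈ X`, the series converging
absolutely, where the coefficients `N^{(p)}(f)` are the iterated Fréchet derivatives of `N`
at `f` (the `p = 0` term of the `HasSum` below being exactly `N f`). -/
def HasEntireExpansionAt (N : X → X) (f : X) : Prop :=
  ∀ x : X,
    HasSum (fun p : ℕ => ((p.factorial : ℝ))⁻¹ •
      iteratedFDeriv ℝ p N f fun _ => x - f) (N x) ∧
    Summable fun p : ℕ => ((p.factorial : ℝ))⁻¹ * ‖iteratedFDeriv ℝ p N f fun _ => x - f‖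

open Finset Filter Topology

/-- The permutations carrying a function to a given rearrangement of it are counted by the product
of the factorials of its fibre cardinalities. -/
theorem card_perm_comp_eq {ι : Type*} [DecidableEq ι] {p : ℕ} (e : Fin p → ι)
    (τ : Equiv.Perm (Fin p)) {s : Finset ι} (hs : ∀ k, e k ∈ s) :
    #{σ : Equiv.Perm (Fin p) | e ∘ σ = e ∘ τ} = ∏ i ∈ s, (#{k | e k = i}).factorial := by
  have h1 : #{σ : Equiv.Perm (Fin p) | e ∘ σ = e ∘ τ} =
      #{g : Equiv.Perm (Fin p) | e ∘ g = e} := by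
    refine card_equiv (Equiv.mulRight τ⁻¹) fun σ => ?_
    simp only [mem_filter, mem_univ, true_and, Equiv.coe_mulRight, Equiv.Perm.coe_mul,
      ← Function.comp_assoc]
    constructor
    · intro h
      rw [h, Function.comp_assoc, ← Equiv.Perm.coe_mul, mul_inv_cancel]
      rfl
    · intro h
      nth_rw 2 [← h]
      rw [Function.comp_assoc, Function.comp_assoc, ← Equiv.Perm.coe_mul, inv_mul_cancel]
      rfl
  rw [h1, ← Fintype.card_subtype, DomMulAct.stabilizer_card']
  simp only [Fintype.card_subtype]
  refine prod_subset (fun i hi => ?_) fun i _ hi => ?_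
  · obtain ⟨k, -, rfl⟩ := mem_image.1 hi
    exact hs k
  · rw [filter_eq_empty_iff.2]
    · simp
    · intro k _ hk
      exact hi (mem_image.2 ⟨k, mem_univ k, hk⟩)

theorem card_rearrangements_mul {ι : Type*} [DecidableEq ι] {p : ℕ} (e : Fin p → ι)
    {s : Finset ι} (hs : ∀ k, e k ∈ s) :
    #(univ.image fun σ : Equiv.Perm (Fin p) => e ∘ σ) * ∏ i ∈ s, (#{k | e k = i}).factorial =
      p.factorial := by
  have h := card_eq_sum_card_image (fun σ : Equiv.Perm (Fin p) => e ∘ σ) univ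
  rw [card_univ, Fintype.card_perm, Fintype.card_fin] at h
  rw [h, sum_const_nat]
  intro b hb
  obtain ⟨τ, -, rfl⟩ := mem_image.1 hb
  exact card_perm_comp_eq e τ hs

theorem exists_comp_perm_eq {ι : Type*} [DecidableEq ι] {p : ℕ} {e e' : Fin p → ι}
    (h : ∀ i, #{k | e k = i} = #{k | e' k = i}) : ∃ σ : Equiv.Perm (Fin p), e ∘ σ = e' := by
  have hc : ∀ i, Nonempty ({k // e' k = i} ≃ {k // e k = i}) := fun i => by
    rw [← Fintype.card_eq, Fintype.card_subtype, Fintype.card_subtype, h]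
  exact ⟨Equiv.ofFiberEquiv fun i => (hc i).some, funext fun k => Equiv.ofFiberEquiv_map _ k⟩

/-- The weight of a finite sequence of indices, an index `i` counting for `i + 1`. -/
def indexWeight (s : Σ p : ℕ, Fin p → ℕ) : ℕ := ∑ k, (s.2 k + 1)

/-- The finite sequences of fewer than `q` indices, all less than `m`. -/
def indexBox (q m : ℕ) : Finset (Σ p : ℕ, Fin p → ℕ) :=
  (range q).sigma fun p => Fintype.piFinset fun _ : Fin p => range m

theorem mem_indexBox {q m : ℕ} {s : Σ p : ℕ, Fin p → ℕ} :
    s ∈ indexBox q m ↔ s.1 < q ∧ ∀ k, s.2 k < m := by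
  simp [indexBox]

theorem mem_indexBox_of_weight_le {n : ℕ} {s : Σ p : ℕ, Fin p → ℕ} (h : indexWeight s ≤ n) :
    s ∈ indexBox (n + 1) n := by
  refine mem_indexBox.2 ⟨?_, fun k => ?_⟩
  · have : s.1 ≤ indexWeight s := by simp [indexWeight, sum_add_distrib]
    omega
  · have : s.2 k + 1 ≤ indexWeight s :=
      single_le_sum (f := fun k => s.2 k + 1) (fun _ _ => Nat.zero_le _) (mem_univ k)
    omega

/-- The finite sequences of indices of weight `n`. -/
def indexFiber (n : ℕ) : Finset (Σ p : ℕ, Fin p → ℕ) :=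
  {s ∈ indexBox (n + 1) n | indexWeight s = n}

theorem mem_indexFiber {n : ℕ} {s : Σ p : ℕ, Fin p → ℕ} :
    s ∈ indexFiber n ↔ indexWeight s = n := by
  simp only [indexFiber, mem_filter, and_iff_right_iff_imp]
  exact fun h => mem_indexBox_of_weight_le h.le

theorem sum_multiplicity_eq {n : ℕ} {s : Σ p : ℕ, Fin p → ℕ} (h : ∀ k, s.2 k < n) :
    ∑ i : Fin n, #{k | s.2 k = i.1} = s.1 := by
  rw [Fin.sum_univ_eq_sum_range (fun i => #{k | s.2 k = i}) n,
    ← card_eq_sum_card_fiberwise (f := s.2) (s := univ) (t := range n)]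
  · simp
  · intro k _
    simpa using h k

theorem sum_mul_multiplicity_eq {n : ℕ} {s : Σ p : ℕ, Fin p → ℕ} (h : ∀ k, s.2 k < n) :
    ∑ i : Fin n, (i.1 + 1) * #{k | s.2 k = i.1} = indexWeight s := by
  rw [Fin.sum_univ_eq_sum_range (fun i => (i + 1) * #{k | s.2 k = i}) n, indexWeight,
    ← sum_fiberwise_of_maps_to (g := s.2) (t := range n) (fun k _ => by simpa using h k)]
  refine sum_congr rfl fun i _ => ?_
  rw [sum_congr rfl (g := fun _ => i + 1) (fun k hk => by rw [(mem_filter.1 hk).2])]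
  simp [mul_comm]

theorem repArgs_comp {X Y : Type*} {n : ℕ} (j : Fin n → ℕ) (g : Fin n → X) (v : X → Y) :
    repArgs j (v ∘ g) = v ∘ repArgs j g := by
  have h : repList j (v ∘ g) = (repList j g).map v := by
    simp [repList, List.map_flatten, List.map_ofFn, Function.comp_def]
  funext k
  simp [repArgs, h]

theorem card_repArgs_eq {n : ℕ} (j : Fin n → ℕ) (i : Fin n) :
    #{k | repArgs j Fin.val k = i.1} = j i := by
  have h1 : #{k | repArgs j Fin.val k = i.1} = (repList j Fin.val).count i.1 := by
    exact Fin.card_filter_univ_eq_vector_get_eq_count i.1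
      (⟨repList j Fin.val, repList_length j _⟩ : List.Vector ℕ (∑ i, j i))
  rw [h1, repList, List.count_flatten, List.map_ofFn, List.sum_ofFn]
  simp [List.count_replicate, Fin.val_inj]

theorem repArgs_lt {n : ℕ} (j : Fin n → ℕ) (k : Fin (∑ i, j i)) : repArgs j Fin.val k < n := by
  have h := repArgs_comp j id Fin.val
  rw [Function.comp_id] at h
  rw [h]
  exact Fin.is_lt _

theorem mem_adomianTuples {n : ℕ} {j : Fin n → ℕ} :
    j ∈ adomianTuples n ↔ ∑ i : Fin n, (i.1 + 1) * j i = n := by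
  simp only [adomianTuples, mem_filter, Fintype.mem_piFinset, mem_range, and_iff_right_iff_imp]
  intro h i
  have h1 : (i.1 + 1) * j i ≤ ∑ i : Fin n, (i.1 + 1) * j i :=
    single_le_sum (f := fun i : Fin n => (i.1 + 1) * j i) (fun _ _ => Nat.zero_le _) (mem_univ i)
  nlinarith

/-- The sequences of weight `n` with multiplicities `j` are the rearrangements of the sorted one. -/
theorem filter_multiplicity_eq {n : ℕ} {j : Fin n → ℕ} (hj : j ∈ adomianTuples n) :
    {s ∈ indexFiber n | (fun i : Fin n => #{k | s.2 k = i.1}) = j} =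
      (univ.image fun σ : Equiv.Perm (Fin (∑ i, j i)) => repArgs j Fin.val ∘ σ).map
        (Function.Embedding.sigmaMk _) := by
  ext ⟨p, e⟩
  rw [mem_filter, mem_indexFiber, Finset.mem_map]
  constructor
  · rintro ⟨hw, hm⟩
    have hlt : ∀ k, e k < n := (mem_indexBox.1 (mem_indexBox_of_weight_le hw.le)).2
    have hp := sum_multiplicity_eq (s := ⟨p, e⟩) hlt
    simp only [funext_iff] at hm
    simp only [hm] at hp
    subst hp
    obtain ⟨σ, hσ⟩ := exists_comp_perm_eq (e := repArgs j Fin.val) (e' := e) fun i => by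
      by_cases hi : i < n
      · exact (card_repArgs_eq j ⟨i, hi⟩).trans (hm ⟨i, hi⟩).symm
      · rw [filter_eq_empty_iff.2, filter_eq_empty_iff.2]
        · exact fun k _ hk => hi (hk ▸ hlt k)
        · exact fun k _ hk => hi (hk ▸ repArgs_lt j k)
    exact ⟨e, mem_image.2 ⟨σ, mem_univ _, hσ⟩, rfl⟩
  · rintro ⟨e', he', heq⟩
    obtain ⟨σ, -, rfl⟩ := mem_image.1 he'
    rw [← heq]
    have hm : ∀ i : Fin n, #{k | (repArgs j Fin.val ∘ σ) k = i.1} = j i := fun i => by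
      rw [← card_repArgs_eq j i]
      exact card_equiv σ fun k => by simp
    refine ⟨?_, funext hm⟩
    rw [← sum_mul_multiplicity_eq (n := n) fun k => repArgs_lt j (σ k)]
    exact (sum_congr rfl fun i _ => congrArg _ (hm i)).trans (mem_adomianTuples.1 hj)

/-- A sum over multi-indices of a symmetric family is a sum over sequences of indices. -/
theorem sum_adomianTuples_eq {X Y : Type*} [AddCommGroup Y] [Module ℝ Y]
    (G : ∀ p : ℕ, (Fin p → X) → Y)
    (hG : ∀ (p : ℕ) (v : Fin p → X) (σ : Equiv.Perm (Fin p)), G p (v ∘ σ) = G p v)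
    (v : ℕ → X) (n : ℕ) :
    ∑ j ∈ adomianTuples n, (∏ i : Fin n, ((j i).factorial : ℝ))⁻¹ •
        G (∑ i : Fin n, j i) (repArgs j fun i => v i.1) =
      ∑ s ∈ indexFiber n, ((s.1.factorial : ℝ))⁻¹ • G s.1 (v ∘ s.2) := by
  rw [← sum_fiberwise_of_maps_to (s := indexFiber n) (t := adomianTuples n)
    (g := fun s (i : Fin n) => #{k | s.2 k = i.1})]
  · refine sum_congr rfl fun j hj => ?_
    rw [filter_multiplicity_eq hj, sum_map,
      sum_congr rfl (g := fun _ => (((∑ i, j i).factorial : ℝ))⁻¹ •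
        G (∑ i : Fin n, j i) (v ∘ repArgs j Fin.val))]
    · rw [sum_const, ← Nat.cast_smul_eq_nsmul ℝ, smul_smul, ← repArgs_comp]
      congr 1
      have h := card_rearrangements_mul (repArgs j Fin.val) (s := range n)
        fun k => mem_range.2 (repArgs_lt j k)
      rw [← Fin.prod_univ_eq_prod_range
        (fun i => (#{k | repArgs j Fin.val k = i}).factorial) n] at h
      simp only [card_repArgs_eq] at h
      rw [← h]
      have h0 : (∏ i : Fin n, ((j i).factorial : ℝ)) ≠ 0 :=
        prod_ne_zero_iff.2 fun i _ => Nat.cast_ne_zero.2 (Nat.factorial_ne_zero _)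
      have h1 : (#(univ.image fun σ : Equiv.Perm (Fin (∑ i, j i)) =>
          repArgs j Fin.val ∘ σ) : ℝ) ≠ 0 := by
        refine Nat.cast_ne_zero.2 fun h2 => ?_
        rw [h2, zero_mul] at h
        exact Nat.factorial_ne_zero _ h.symm
      push_cast
      field_simp
    · intro e he
      obtain ⟨σ, -, rfl⟩ := mem_image.1 he
      exact congrArg _ (hG _ (v ∘ repArgs j Fin.val) σ)
  · intro s hs
    have hw := mem_indexFiber.1 hs
    rw [mem_adomianTuples, sum_mul_multiplicity_eq, hw]
    exact (mem_indexBox.1 (mem_indexBox_of_weight_le hw.le)).2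

/-- Expansion of a continuous multilinear map at the sum of a series. -/
theorem ContinuousMultilinearMap.hasSum_comp_of_summable {E F : Type*}
    [NormedAddCommGroup E] [NormedSpace ℝ E] [NormedAddCommGroup F] [NormedSpace ℝ F] {p : ℕ}
    (G : ContinuousMultilinearMap ℝ (fun _ : Fin p => E) F) {v : ℕ → E} {w : E}
    (hv : HasSum v w) (hG : Summable fun e : Fin p → ℕ => G (v ∘ e)) :
    HasSum (fun e : Fin p → ℕ => G (v ∘ e)) (G fun _ => w) := by
  have hbox : Tendsto (fun m => Fintype.piFinset fun _ : Fin p => range m) atTop atTop := by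
    refine tendsto_atTop_finset_of_monotone
      (fun m m' h => Fintype.piFinset_subset _ _ fun _ => range_mono h) fun e => ?_
    refine ⟨univ.sup e + 1, Fintype.mem_piFinset.2 fun k => ?_⟩
    exact mem_range.2 (Nat.lt_succ_of_le (le_sup (mem_univ k)))
  have h1 := hG.hasSum.comp hbox
  have h2 : Tendsto (fun m => G fun _ => ∑ i ∈ range m, v i) atTop (𝓝 (G fun _ => w)) :=
    (G.cont.tendsto _).comp (tendsto_pi_nhds.2 fun _ => hv.tendsto_sum_nat)
  have h3 : (fun m => G fun _ => ∑ i ∈ range m, v i) =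
      (fun t => ∑ e ∈ t, G (v ∘ e)) ∘ fun m => Fintype.piFinset fun _ : Fin p => range m :=
    funext fun m => G.map_sum_finset (fun _ => v) fun _ => range m
  rw [h3] at h2
  rw [← tendsto_nhds_unique h1 h2]
  exact hG.hasSum

theorem sum_indexBox_le {M a : ℝ} (hM : 0 ≤ M) (ha : 0 < a) {b : ℕ → ℝ} (hb : ∀ i, 0 ≤ b i)
    {m : ℕ} (hbm : ∑ i ∈ range m, b i ≤ 1 / (2 * a)) (q : ℕ) :
    ∑ s ∈ indexBox q m, M * a ^ s.1 * ∏ k, b (s.2 k) ≤ 2 * M := by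
  have h0 : 0 ≤ ∑ i ∈ range m, b i := sum_nonneg fun i _ => hb i
  rw [le_div_iff₀ (by positivity)] at hbm
  calc ∑ s ∈ indexBox q m, M * a ^ s.1 * ∏ k, b (s.2 k)
      = ∑ p ∈ range q, M * (a * ∑ i ∈ range m, b i) ^ p := by
        rw [indexBox, sum_sigma]
        refine sum_congr rfl fun p _ => ?_
        simp only [← mul_sum]
        rw [← prod_univ_sum (fun _ : Fin p => range m) fun _ i => b i]
        simp [mul_pow, mul_assoc]
    _ ≤ ∑ p ∈ range q, M * (1 / 2) ^ p := by
        gcongr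
        linarith
    _ ≤ 2 * M := by
        rw [← mul_sum, mul_comm]
        exact mul_le_mul_of_nonneg_right (sum_geometric_two_le q) hM

theorem HasEntireExpansionAt.analyticAt {E : Type*} [NormedAddCommGroup E]
    [NormedSpace ℝ E] {N : E → E} {f : E} (hN : HasEntireExpansionAt N f)
    {M a : ℝ} (ha : 0 < a)
    (hderiv : ∀ n : ℕ, ‖iteratedFDeriv ℝ n N f‖ ≤ M * a ^ n * n.factorial) :
    AnalyticAt ℝ N f := by
  let P : FormalMultilinearSeries ℝ E E := fun p =>
    ((p.factorial : ℝ))⁻¹ • iteratedFDeriv ℝ p N f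
  have hr : (0 : ℝ) ≤ a⁻¹ := by positivity
  refine ⟨P, ENNReal.ofNNReal ⟨a⁻¹, hr⟩, P.le_radius_of_bound M fun n => ?_, ?_, fun {y} _ => ?_⟩
  · have h0 : (0 : ℝ) < n.factorial := Nat.cast_pos.2 n.factorial_pos
    change ‖((n.factorial : ℝ))⁻¹ • iteratedFDeriv ℝ n N f‖ * a⁻¹ ^ n ≤ M
    rw [norm_smul, norm_inv, Real.norm_of_nonneg h0.le]
    calc _ ≤ ((n.factorial : ℝ))⁻¹ * (M * a ^ n * n.factorial) * a⁻¹ ^ n := by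
          gcongr
          exact hderiv n
      _ = M * (a * a⁻¹) ^ n := by
          rw [mul_pow]
          field_simp
      _ = M := by rw [mul_inv_cancel₀ ha.ne', one_pow, mul_one]
  · exact ENNReal.coe_pos.2 (inv_pos.2 ha)
  · simpa [P] using (hN (f + y)).1

theorem norm_smul_iteratedFDeriv_le {E : Type*} [NormedAddCommGroup E] [NormedSpace ℝ E]
    {N : E → E} {f : E} {M a : ℝ}
    (hderiv : ∀ n : ℕ, ‖iteratedFDeriv ℝ n N f‖ ≤ M * a ^ n * n.factorial) (p : ℕ)
    (x : Fin p → E) :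
    ‖((p.factorial : ℝ))⁻¹ • iteratedFDeriv ℝ p N f x‖ ≤ M * a ^ p * ∏ k, ‖x k‖ := by
  have h0 : (0 : ℝ) < p.factorial := Nat.cast_pos.2 p.factorial_pos
  rw [norm_smul, norm_inv, Real.norm_of_nonneg h0.le]
  calc _ ≤ ((p.factorial : ℝ))⁻¹ * (M * a ^ p * p.factorial * ∏ k, ‖x k‖) := by
        gcongr
        exact ((iteratedFDeriv ℝ p N f).le_opNorm x).trans (by gcongr; exact hderiv p)
    _ = M * a ^ p * ∏ k, ‖x k‖ := by field_simp

theorem adomianA_eq_sum_indexFiber {N : X → X} {f : X} (hN : AnalyticAt ℝ N f) (u : ℕ → X)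
    (n : ℕ) :
    adomianA N f u n = ∑ s ∈ indexFiber n,
      ((s.1.factorial : ℝ))⁻¹ • iteratedFDeriv ℝ s.1 N f ((fun i => u (i + 1)) ∘ s.2) :=
  sum_adomianTuples_eq (fun p => iteratedFDeriv ℝ p N f)
    (fun _ v σ => hN.contDiffAt.iteratedFDeriv_comp_perm v σ) (fun i => u (i + 1)) n

theorem sum_norm_adomian_le {N : X → X} {f : X} {M a : ℝ} (hM : 0 < M) (ha : 0 < a)
    (hMa : M * a ≤ 1 / 4) (hN : HasEntireExpansionAt N f)
    (hderiv : ∀ n : ℕ, ‖iteratedFDeriv ℝ n N f‖ ≤ M * a ^ n * n.factorial)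
    {u : ℕ → X} (hu : ∀ n : ℕ, u (n + 1) = adomianA N f u n) (m : ℕ) :
    ∑ i ∈ range m, ‖u (i + 1)‖ ≤ 1 / (2 * a) := by
  induction m with
  | zero => simp; positivity
  | succ m ih =>
    let T : (Σ p : ℕ, Fin p → ℕ) → ℝ := fun s => M * a ^ s.1 * ∏ k, ‖u (s.2 k + 1)‖
    have hT : ∀ s, 0 ≤ T s := fun s => by positivity
    calc ∑ i ∈ range (m + 1), ‖u (i + 1)‖
        ≤ ∑ i ∈ range (m + 1), ∑ s ∈ indexFiber i, T s := by
          refine sum_le_sum fun i _ => ?_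
          rw [hu, adomianA_eq_sum_indexFiber (hN.analyticAt ha hderiv)]
          exact norm_sum_le_of_le _ fun s _ => norm_smul_iteratedFDeriv_le hderiv _ _
      _ = ∑ s ∈ (range (m + 1)).biUnion indexFiber, T s := by
          refine (sum_biUnion fun i _ i' _ hne => disjoint_left.2 fun s h h' => hne ?_).symm
          rw [← mem_indexFiber.1 h, mem_indexFiber.1 h']
      _ ≤ ∑ s ∈ indexBox (m + 1) m, T s := by
          refine sum_le_sum_of_subset_of_nonneg (fun s hs => ?_) fun s _ _ => hT s
          obtain ⟨i, hi, hs⟩ := mem_biUnion.1 hs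
          refine mem_indexBox_of_weight_le ?_
          rw [mem_indexFiber.1 hs]
          exact Nat.lt_succ_iff.1 (mem_range.1 hi)
      _ ≤ 2 * M := sum_indexBox_le hM.le ha (fun i => norm_nonneg _) ih _
      _ ≤ 1 / (2 * a) := by
          rw [le_div_iff₀ (by positivity)]
          linarith

theorem summable_index_of_sum_le {M a : ℝ} (hM : 0 ≤ M) (ha : 0 < a) {b : ℕ → ℝ}
    (hb : ∀ i, 0 ≤ b i) (hbm : ∀ m, ∑ i ∈ range m, b i ≤ 1 / (2 * a)) :
    Summable fun s : Σ p : ℕ, Fin p → ℕ => M * a ^ s.1 * ∏ k, b (s.2 k) := by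
  have h0 : ∀ s : Σ p : ℕ, Fin p → ℕ, 0 ≤ M * a ^ s.1 * ∏ k, b (s.2 k) := fun s =>
    mul_nonneg (by positivity) (prod_nonneg fun k _ => hb _)
  refine summable_of_sum_le h0 (c := 2 * M) fun t => ?_
  refine le_trans (sum_le_sum_of_subset_of_nonneg (fun s hs => ?_) fun s _ _ => h0 s)
    (sum_indexBox_le hM ha hb (hbm (t.sup indexWeight)) (t.sup indexWeight + 1))
  exact mem_indexBox_of_weight_le (le_sup (f := indexWeight) hs)

/-- Under the hypotheses `‖N^{(n)}(f)‖ ≤ M a^n n!` with `M, a > 0` and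
`M a ≤ 1/4`, for every `ε ∈ [0,1]` the series `U(ε) = ∑_{n=0}^∞ ε^n u_n` converges absolutely
in `X` and `N(U(ε)) = ∑_{n=0}^∞ ε^n u_{n+1} (= ∑_{n=0}^∞ ε^n A_n)`, the latter series also
converging absolutely. -/
theorem adomian_parametrized_identity
    (N : X → X) (f : X) (M a : ℝ) (hM : 0 < M) (ha : 0 < a) (hMa : M * a ≤ 1 / 4)
    (hN : HasEntireExpansionAt N f)
    (hderiv : ∀ n : ℕ, ‖iteratedFDeriv ℝ n N f‖ ≤ M * a ^ n * n.factorial)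
    (u : ℕ → X) (hu0 : u 0 = f) (hu : ∀ n : ℕ, u (n + 1) = adomianA N f u n) :
    ∀ ε ∈ Set.Icc (0 : ℝ) 1,
      (Summable fun n : ℕ => ‖ε ^ n • u n‖) ∧
      (Summable fun n : ℕ => ‖ε ^ n • u (n + 1)‖) ∧
      HasSum (fun n : ℕ => ε ^ n • u (n + 1)) (N (∑' n : ℕ, ε ^ n • u n)) := by
  rintro ε ⟨h0, h1⟩
  have hbound := sum_norm_adomian_le hM ha hMa hN hderiv hu
  have hsum : Summable fun i => ‖u (i + 1)‖ :=
    summable_of_sum_range_le (fun i => norm_nonneg _) hbound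
  have hle : ∀ n i, ‖ε ^ n • u (i + 1)‖ ≤ ‖u (i + 1)‖ := fun n i => by
    rw [norm_smul, norm_pow, Real.norm_of_nonneg h0]
    exact mul_le_of_le_one_left (norm_nonneg _) (pow_le_one₀ h0 h1)
  have hs1 : Summable fun n => ‖ε ^ n • u (n + 1)‖ :=
    hsum.of_nonneg_of_le (fun _ => norm_nonneg _) fun n => hle n n
  let v : ℕ → X := fun i => ε ^ (i + 1) • u (i + 1)
  have hv : Summable fun i => ‖v i‖ :=
    hsum.of_nonneg_of_le (fun _ => norm_nonneg _) fun n => hle (n + 1) n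
  have hs0 : Summable fun n => ‖ε ^ n • u n‖ :=
    (summable_nat_add_iff (f := fun n => ‖ε ^ n • u n‖) 1).1 hv
  refine ⟨hs0, hs1, ?_⟩
  have hw : HasSum v (∑' n, ε ^ n • u n - f) := by
    have h := (hasSum_nat_add_iff' (f := fun n => ε ^ n • u n) 1).2 hs0.of_norm.hasSum
    simpa [hu0] using h
  let T : (Σ p : ℕ, Fin p → ℕ) → X := fun s =>
    ((s.1.factorial : ℝ))⁻¹ • iteratedFDeriv ℝ s.1 N f (v ∘ s.2)
  have hT : Summable T := by
    refine Summable.of_norm_bounded (summable_index_of_sum_le hM.le ha (b := fun i => ‖v i‖)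
      (fun i => norm_nonneg _) fun m => (sum_le_sum fun i _ => hle (i + 1) i).trans (hbound m))
      fun s => norm_smul_iteratedFDeriv_le hderiv _ _
  have hTN : HasSum T (N (∑' n, ε ^ n • u n)) := by
    have h := hT.hasSum.sigma fun p =>
      (((p.factorial : ℝ))⁻¹ • iteratedFDeriv ℝ p N f).hasSum_comp_of_summable hw
        (hT.sigma_factor p)
    rw [(hN _).1.unique h]
    exact hT.hasSum
  have hTw : ∀ s, T s = ε ^ indexWeight s •
      ((s.1.factorial : ℝ))⁻¹ • iteratedFDeriv ℝ s.1 N f ((fun i => u (i + 1)) ∘ s.2) := fun s => by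
    have h := (iteratedFDeriv ℝ s.1 N f).map_smul_univ (fun k => ε ^ (s.2 k + 1))
      fun k => u (s.2 k + 1)
    rw [prod_pow_eq_pow_sum] at h
    rw [smul_comm]
    exact congrArg _ h
  convert! hTN.tsum_fiberwise indexWeight using 2 with n
  have hset : indexWeight ⁻¹' {n} = (indexFiber n : Set (Σ p : ℕ, Fin p → ℕ)) :=
    Set.ext fun s => mem_indexFiber.symm
  rw [hset, Finset.tsum_subtype' (indexFiber n) T, hu,
    adomianA_eq_sum_indexFiber (hN.analyticAt ha hderiv), smul_sum]
  exact sum_congr rfl fun s hs => by rw [hTw, mem_indexFiber.1 hs]
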